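/- Norms of the random features matrix and uniform feature norms (Lemma A.5). In the random features setup with φ non-linear, Lipschitz, with Lipschitz derivative and μ_1 ≠ 0, and with p ≥ d: there exist constants c, C, c' > 0 such that with probability at least 1 − 2 exp(−c log² d) over V, the following hold jointly: (i) ‖V‖_op ≤ C √(p/d); (ii) ‖V‖_F² ≤ C p; (iii) Σ_{k=1}^p ‖v_k‖_2³ ≤ C p; (iv) c' √p ≤ sup_{x : ‖x‖_2 = √d} ‖φ(x)‖_2 ≤ C √p; and (v) c' √p ≤ sup_{x : ‖x‖_2 = √d} ‖φ̃(x)‖_2 ≤ C √p. -/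

import Mathlib

open MeasureTheory ProbabilityTheory Filter

noncomputable section

/-- Euclidean (ℓ²) norm of a vector in `Fin m → ℝ`. -/
def eNorm {m : ℕ} (x : Fin m → ℝ) : ℝ := Real.sqrt (∑ j, (x j) ^ 2)

/-- Euclidean dot product. -/
def dotp {m : ℕ} (u v : Fin m → ℝ) : ℝ := ∑ j, u j * v j

/-- The random-features map `x ↦ (φ(vₖᵀx))ₖ`, where `vₖ` is the `k`-th row of `V`. -/
def featureMap {p d : ℕ} (φ : ℝ → ℝ) (V : Fin p → Fin d → ℝ) (x : Fin d → ℝ) :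
    Fin p → ℝ := fun k => φ (dotp (V k) x)

/-- The `l`-th normalized probabilists' Hermite polynomial (orthonormal in `L²(N(0,1))`). -/
def hermiteFn (l : ℕ) (x : ℝ) : ℝ :=
  (Polynomial.aeval x (Polynomial.hermite l)) / Real.sqrt (Nat.factorial l)

/-- The `l`-th Hermite coefficient `μ_l` of `φ`. -/
def hermiteCoeff (φ : ℝ → ℝ) (l : ℕ) : ℝ :=
  ∫ g, φ g * hermiteFn l g ∂(gaussianReal 0 1)

/-- The nonlinear part of the feature map: `φ̃(x) = (φ(vₖᵀx) − μ₁ vₖᵀx)ₖ`. -/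
def tfeatureMap {p d : ℕ} (φ : ℝ → ℝ) (V : Fin p → Fin d → ℝ) (x : Fin d → ℝ) :
    Fin p → ℝ := fun k => φ (dotp (V k) x) - hermiteCoeff φ 1 * dotp (V k) x

/-- `μ̃² := Σ_{l ≥ 3} μ_l²`. -/
def tmu2 (φ : ℝ → ℝ) : ℝ := ∑' l : ℕ, if 3 ≤ l then (hermiteCoeff φ l) ^ 2 else 0

/-- The law of the random features matrix: i.i.d. entries `N(0, 1/d)`. -/
def gaussianMatrix (p d : ℕ) : Measure (Fin p → Fin d → ℝ) :=
  Measure.pi fun _ => Measure.pi fun _ => gaussianReal 0 ((d : NNReal))⁻¹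

/-- Sub-Gaussian norm of a distribution on `ℝ^d`:
`sup_{‖u‖₂ = 1} inf { t > 0 : E exp((uᵀx)²/t²) ≤ 2 }`. -/
def vecSubGNorm {d : ℕ} (P : Measure (Fin d → ℝ)) : ℝ :=
  ⨆ u : {u : Fin d → ℝ // eNorm u = 1},
    sInf {t : ℝ | 0 < t ∧ ∫ x, Real.exp ((dotp u.1 x) ^ 2 / t ^ 2) ∂P ≤ 2}

/-- Data assumption: `P` is a probability distribution on `ℝ^d` with `‖x‖₂ = √d` a.s.
and sub-Gaussian norm at most `K`. -/
structure DataAssumption {d : ℕ} (P : Measure (Fin d → ℝ)) (K : ℝ) : Prop where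
  prob : IsProbabilityMeasure P
  norm_eq : ∀ᵐ x ∂P, eNorm x = Real.sqrt d
  subg : vecSubGNorm P ≤ K

/-- Core activation assumption: `φ` is non-linear, Lipschitz, with Lipschitz derivative,
`μ₀ = μ₂ = 0` and `μ₁ ≠ 0`. -/
structure ActivationAssumptionCore (φ : ℝ → ℝ) : Prop where
  nonlinear : ¬ ∃ a b : ℝ, ∀ z, φ z = a * z + b
  lipschitz : ∃ L : NNReal, LipschitzWith L φ
  differentiable : Differentiable ℝ φ
  deriv_lipschitz : ∃ L' : NNReal, LipschitzWith L' (deriv φ)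
  mu0 : hermiteCoeff φ 0 = 0
  mu2 : hermiteCoeff φ 2 = 0
  mu1 : hermiteCoeff φ 1 ≠ 0

/-- Full activation assumption: additionally, there are two non-zero Hermite coefficients
of order ≥ 3 with different parity. -/
structure ActivationAssumption (φ : ℝ → ℝ) extends ActivationAssumptionCore φ : Prop where
  parity : ∃ l l' : ℕ, 3 ≤ l ∧ 3 ≤ l' ∧ l % 2 ≠ l' % 2 ∧
    hermiteCoeff φ l ≠ 0 ∧ hermiteCoeff φ l' ≠ 0

lemma gauss_exp_sq (a : ℝ) (v : NNReal) (hav : a * v ≤ 1 / 4) :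
    ∫⁻ x, ENNReal.ofReal (Real.exp (a * x ^ 2)) ∂(gaussianReal 0 v)
      ≤ ENNReal.ofReal (Real.sqrt 2) := by
  by_cases hv : v = 0
  · subst hv
    rw [gaussianReal_zero_var, lintegral_dirac]
    simp only [ne_eq, OfNat.ofNat_ne_zero, not_false_eq_true, zero_pow, mul_zero, Real.exp_zero]
    apply ENNReal.ofReal_le_ofReal
    rw [Real.one_le_sqrt]; norm_num
  have hv0 : (0 : ℝ) < v := by exact_mod_cast pos_iff_ne_zero.mpr hv
  rw [gaussianReal_of_var_ne_zero _ hv, lintegral_withDensity_eq_lintegral_mul _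
    (measurable_gaussianPDF 0 v) (by fun_prop)]
  set b : ℝ := 1 / (2 * v) - a with hb
  have hb4 : 1 / (4 * (v : ℝ)) ≤ b := by
    have : a ≤ 1 / (4 * (v : ℝ)) := by
      rw [le_div_iff₀ (by positivity)]; linarith
    have h2 : 1 / (2 * (v : ℝ)) = 1 / (4 * (v : ℝ)) + 1 / (4 * (v : ℝ)) := by
      field_simp; norm_num
    rw [hb, h2]; linarith
  have hb0 : 0 < b := lt_of_lt_of_le (by positivity) hb4
  have heq : ∀ x : ℝ, (gaussianPDF 0 v * fun x => ENNReal.ofReal (Real.exp (a * x ^ 2))) x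
      = ENNReal.ofReal ((Real.sqrt (2 * Real.pi * v))⁻¹ * Real.exp (-b * x ^ 2)) := by
    intro x
    simp only [Pi.mul_apply, gaussianPDF, gaussianPDFReal]
    rw [← ENNReal.ofReal_mul (by positivity), mul_assoc, ← Real.exp_add]
    congr 3
    rw [hb]; field_simp; ring
  rw [lintegral_congr heq, ← ofReal_integral_eq_lintegral_ofReal
    ((integrable_exp_neg_mul_sq hb0).const_mul _) (ae_of_all _ fun x => by positivity)]
  apply ENNReal.ofReal_le_ofReal
  rw [integral_const_mul, integral_gaussian, ← Real.sqrt_inv, ← Real.sqrt_mul (by positivity)]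
  apply Real.sqrt_le_sqrt
  rw [div_eq_mul_inv]
  have : b⁻¹ ≤ 4 * v := by
    rw [inv_le_comm₀ hb0 (by positivity)]; simpa using hb4
  calc (2 * Real.pi * v)⁻¹ * (Real.pi * b⁻¹) ≤ (2 * Real.pi * v)⁻¹ * (Real.pi * (4 * v)) := by
        gcongr
    _ = 2 := by
        have := Real.pi_pos
        field_simp; norm_num

lemma pi_lintegral_prod {ι Ω : Type*} [Fintype ι] [MeasurableSpace Ω] (μ : Measure Ω)
    [IsProbabilityMeasure μ] (f : ι → Ω → ENNReal) (hf : ∀ i, Measurable (f i)) :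
    ∫⁻ ω, ∏ i, f i (ω i) ∂(Measure.pi fun _ : ι => μ) = ∏ i, ∫⁻ x, f i x ∂μ := by
  have h := iIndepFun_pi (μ := fun _ : ι => μ) (X := f) (fun i => (hf i).aemeasurable)
  rw [lintegral_prod_eq_prod_lintegral_of_indepFun _ (fun i (ω : ι → Ω) => f i (ω i)) h
    (fun i => (hf i).comp (measurable_pi_apply i))]
  refine Finset.prod_congr rfl fun i _ => ?_
  exact (measurePreserving_eval (fun _ : ι => μ) i).lintegral_comp (hf i)

/-- law of one row of the matrix -/
def rowLaw (d : ℕ) : Measure (Fin d → ℝ) :=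
  Measure.pi fun _ => gaussianReal 0 ((d : NNReal))⁻¹

instance (d : ℕ) : IsProbabilityMeasure (rowLaw d) := by unfold rowLaw; infer_instance

lemma gaussianMatrix_eq (p d : ℕ) : gaussianMatrix p d = Measure.pi fun _ => rowLaw d := rfl

instance (p d : ℕ) : IsProbabilityMeasure (gaussianMatrix p d) := by
  unfold gaussianMatrix; infer_instance

lemma measurable_dotp {d : ℕ} (x : Fin d → ℝ) : Measurable fun v : Fin d → ℝ => dotp v x := by
  unfold dotp; fun_prop

lemma dotp_law (d : ℕ) (x : Fin d → ℝ) :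
    (rowLaw d).map (fun v => dotp v x)
      = gaussianReal 0 ((d : NNReal)⁻¹ * Real.toNNReal (∑ j, (x j) ^ 2)) := by
  have hm := measurable_dotp x
  have := Measure.isProbabilityMeasure_map (μ := rowLaw d) hm.aemeasurable
  apply Measure.ext_of_charFun
  funext t
  rw [charFun_gaussianReal, charFun_apply_real, integral_map hm.aemeasurable (by fun_prop)]
  have : ∀ v : Fin d → ℝ, Complex.exp (t * (dotp v x : ℝ) * Complex.I)
      = ∏ j, Complex.exp ((t * x j : ℝ) * (v j : ℝ) * Complex.I) := by
    intro v
    rw [← Complex.exp_sum]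
    congr 1
    unfold dotp
    push_cast
    rw [Finset.mul_sum, Finset.sum_mul]
    exact Finset.sum_congr rfl fun j _ => by ring
  simp_rw [this]
  unfold rowLaw
  rw [integral_fintype_prod_eq_prod
    (f := fun j (y : ℝ) => Complex.exp ((t * x j : ℝ) * (y : ℝ) * Complex.I))]
  simp_rw [← charFun_apply_real, charFun_gaussianReal]
  rw [← Complex.exp_sum]
  congr 1
  have hn : (0 : ℝ) ≤ ∑ j, (x j) ^ 2 := Finset.sum_nonneg fun _ _ => sq_nonneg _
  push_cast
  rw [Real.coe_toNNReal _ hn]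
  push_cast
  simp only [mul_zero, zero_mul, zero_sub, Finset.sum_neg_distrib, neg_inj]
  rw [Finset.mul_sum, Finset.sum_mul, Finset.sum_div]
  refine Finset.sum_congr rfl fun j _ => ?_
  ring

lemma row_exp_dotp (d : ℕ) (hd : 0 < d) (x : Fin d → ℝ) (a : ℝ)
    (h : a * (∑ j, (x j) ^ 2) ≤ d / 4) :
    ∫⁻ v, ENNReal.ofReal (Real.exp (a * (dotp v x) ^ 2)) ∂(rowLaw d)
      ≤ ENNReal.ofReal (Real.sqrt 2) := by
  have := lintegral_map (μ := rowLaw d) (f := fun y => ENNReal.ofReal (Real.exp (a * y ^ 2)))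
    (by fun_prop) (measurable_dotp x)
  rw [← this, dotp_law]
  apply gauss_exp_sq _ _
  push_cast
  rw [Real.coe_toNNReal _ (Finset.sum_nonneg fun _ _ => sq_nonneg _)]
  have hd' : (0 : ℝ) < d := by exact_mod_cast hd
  rw [mul_left_comm, inv_mul_le_iff₀ hd']
  linarith

lemma row_exp_norm (d : ℕ) (hd : 0 < d) :
    ∫⁻ v, ENNReal.ofReal (Real.exp ((d : ℝ) / 4 * ∑ j, (v j) ^ 2)) ∂(rowLaw d)
      ≤ ENNReal.ofReal (Real.sqrt 2) ^ d := by
  have hd' : (0 : ℝ) < d := by exact_mod_cast hd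
  have h : ∀ v : Fin d → ℝ, ENNReal.ofReal (Real.exp ((d : ℝ) / 4 * ∑ j, (v j) ^ 2))
      = ∏ j, ENNReal.ofReal (Real.exp ((d : ℝ) / 4 * (v j) ^ 2)) := by
    intro v
    rw [← ENNReal.ofReal_prod_of_nonneg (fun _ _ => by positivity), ← Real.exp_sum,
      Finset.mul_sum]
  rw [lintegral_congr h]
  unfold rowLaw
  rw [pi_lintegral_prod _ (fun _ y => ENNReal.ofReal (Real.exp ((d : ℝ) / 4 * y ^ 2)))
    (fun _ => by fun_prop)]
  calc _ ≤ ∏ _j : Fin d, ENNReal.ofReal (Real.sqrt 2) := by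
        refine Finset.prod_le_prod' fun j _ => gauss_exp_sq _ _ ?_
        push_cast
        field_simp; norm_num
    _ = _ := by simp

lemma mat_exp (p d : ℕ) (g : (Fin d → ℝ) → ℝ) (hg : Measurable g) :
    ∫⁻ V, ENNReal.ofReal (Real.exp (∑ k, g (V k))) ∂(gaussianMatrix p d)
      = (∫⁻ v, ENNReal.ofReal (Real.exp (g v)) ∂(rowLaw d)) ^ p := by
  have h : ∀ V : Fin p → Fin d → ℝ, ENNReal.ofReal (Real.exp (∑ k, g (V k)))
      = ∏ k, ENNReal.ofReal (Real.exp (g (V k))) := by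
    intro v
    rw [← ENNReal.ofReal_prod_of_nonneg (fun _ _ => by positivity), ← Real.exp_sum]
  rw [lintegral_congr h, gaussianMatrix_eq,
    pi_lintegral_prod _ (fun _ v => ENNReal.ofReal (Real.exp (g v))) (fun _ => by fun_prop)]
  simp

/-- Markov inequality, real form. -/
lemma markov {α : Type*} [MeasurableSpace α] (μ : Measure α) (f : α → ℝ) (hf : Measurable f)
    (e b : ℝ) (he : 0 < e)
    (h : ∫⁻ x, ENNReal.ofReal (f x) ∂μ ≤ ENNReal.ofReal b) :
    μ {x | e ≤ f x} ≤ ENNReal.ofReal (b / e) := by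
  have h1 := meas_ge_le_lintegral_div (μ := μ) (f := fun x => ENNReal.ofReal (f x))
    (by fun_prop) (ε := ENNReal.ofReal e) (by simpa using he) ENNReal.ofReal_ne_top
  rw [ENNReal.ofReal_div_of_pos he]
  refine le_trans (measure_mono ?_) (h1.trans (by gcongr))
  intro x hx
  exact ENNReal.ofReal_le_ofReal hx

/-- Lattice net. -/
def latNet (d : ℕ) : Finset (Fin d → ℤ) :=
  (Fintype.piFinset fun _ => Finset.Icc (-(2 * d : ℤ)) (2 * d)).filter
    (fun z => ∑ j, ((z j : ℤ) : ℝ) ^ 2 ≤ 9 / 4 * d)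

lemma summable_exp_int : Summable fun z : ℤ => Real.exp (-((z : ℝ) ^ 2)) := by
  have h : Summable fun n : ℕ => Real.exp (-((n : ℝ) ^ 2)) := by
    refine Summable.of_nonneg_of_le (fun _ => by positivity) (fun n => ?_) Real.summable_exp_neg_nat
    apply Real.exp_le_exp.mpr
    have : (n : ℝ) ≤ (n : ℝ) ^ 2 := by
      exact_mod_cast Nat.le_self_pow (by norm_num) n
    linarith
  apply Summable.of_nat_of_neg
  · simpa using h
  · simpa using h

lemma latNet_card : ∃ S : ℝ, 1 ≤ S ∧ ∀ d : ℕ, ((latNet d).card : ℝ) ≤ S ^ d := by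
  set S0 : ℝ := ∑' z : ℤ, Real.exp (-((z : ℝ) ^ 2)) with hS0
  have hS1 : 1 ≤ S0 := by
    have := summable_exp_int.le_tsum (0 : ℤ) (fun _ _ => by positivity)
    simpa using this
  refine ⟨Real.exp (9 / 4) * S0, ?_, fun d => ?_⟩
  · have : 1 ≤ Real.exp (9 / 4) := Real.one_le_exp (by norm_num)
    nlinarith
  calc ((latNet d).card : ℝ) = ∑ z ∈ latNet d, (1 : ℝ) := by simp
    _ ≤ ∑ z ∈ latNet d, Real.exp (9 / 4 * d) * ∏ j, Real.exp (-(((z j : ℤ) : ℝ) ^ 2)) := by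
        refine Finset.sum_le_sum fun z hz => ?_
        rw [← Real.exp_sum, ← Real.exp_add]
        apply Real.one_le_exp
        rw [Finset.sum_neg_distrib]
        have := (Finset.mem_filter.mp hz).2
        linarith
    _ ≤ ∑ z ∈ Fintype.piFinset (fun _ : Fin d => Finset.Icc (-(2 * d : ℤ)) (2 * d)),
          Real.exp (9 / 4 * d) * ∏ j, Real.exp (-(((z j : ℤ) : ℝ) ^ 2)) := by
        refine Finset.sum_le_sum_of_subset_of_nonneg (Finset.filter_subset _ _) ?_
        intros; positivity
    _ = Real.exp (9 / 4 * d) * ∏ _j : Fin d,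
          ∑ z ∈ Finset.Icc (-(2 * d : ℤ)) (2 * d), Real.exp (-((z : ℝ) ^ 2)) := by
        rw [← Finset.mul_sum, Finset.prod_univ_sum]
    _ ≤ Real.exp (9 / 4 * d) * ∏ _j : Fin d, S0 := by
        gcongr
        exact summable_exp_int.sum_le_tsum _ (fun _ _ => by positivity)
    _ = _ := by
        rw [mul_pow, ← Real.exp_nat_mul]
        simp [mul_comm]

lemma eNorm_sq {m : ℕ} (x : Fin m → ℝ) : eNorm x ^ 2 = ∑ j, (x j) ^ 2 :=
  Real.sq_sqrt (Finset.sum_nonneg fun _ _ => sq_nonneg _)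

lemma eNorm_nonneg {m : ℕ} (x : Fin m → ℝ) : 0 ≤ eNorm x := Real.sqrt_nonneg _

lemma eNorm_eq {m : ℕ} (x : Fin m → ℝ) : eNorm x = ‖(WithLp.toLp 2 x : EuclideanSpace ℝ (Fin m))‖ := by
  rw [EuclideanSpace.norm_eq]
  simp [eNorm]

/-- net point -/
def latPt {d : ℕ} (z : Fin d → ℤ) : Fin d → ℝ := fun j => (z j : ℝ) / Real.sqrt d

lemma latPt_sq {d : ℕ} (hd : 0 < d) {z : Fin d → ℤ} (hz : z ∈ latNet d) :
    ∑ j, (latPt z j) ^ 2 ≤ 9 / 4 := by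
  have hd' : (0 : ℝ) < d := by exact_mod_cast hd
  have := (Finset.mem_filter.mp hz).2
  simp only [latPt, div_pow, Real.sq_sqrt hd'.le, ← Finset.sum_div]
  rw [div_le_iff₀ hd']
  exact this

lemma latNet_round {d : ℕ} (hd : 0 < d) (u : Fin d → ℝ) (hu : eNorm u = 1) :
    ∃ z ∈ latNet d, eNorm (fun j => u j - latPt z j) ≤ 1 / 2 := by
  have hd' : (0 : ℝ) < d := by exact_mod_cast hd
  have hd1 : (1 : ℝ) ≤ d := by exact_mod_cast hd
  have hs : 0 < Real.sqrt d := Real.sqrt_pos.mpr hd'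
  have hu2 : ∑ j, (u j) ^ 2 = 1 := by rw [← eNorm_sq, hu]; norm_num
  set z : Fin d → ℤ := fun j => round (Real.sqrt d * u j) with hz
  have he : ∀ j, (Real.sqrt d * u j - z j) ^ 2 ≤ 1 / 4 := by
    intro j
    have := abs_sub_round (Real.sqrt d * u j)
    rw [← sq_abs]
    have h0 := abs_nonneg (Real.sqrt d * u j - z j)
    nlinarith
  have hzs : ∑ j, ((z j : ℤ) : ℝ) ^ 2 ≤ 9 / 4 * d := by
    calc ∑ j, ((z j : ℤ) : ℝ) ^ 2 ≤ ∑ j, (3 / 2 * (d * (u j) ^ 2) + 3 / 4) := by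
          refine Finset.sum_le_sum fun j _ => ?_
          have h1 := he j
          have h2 : (Real.sqrt d * u j) ^ 2 = d * (u j) ^ 2 := by
            rw [mul_pow, Real.sq_sqrt hd'.le]
          rw [← h2]
          nlinarith [sq_nonneg (Real.sqrt d * u j - 2 * (Real.sqrt d * u j - z j)),
            sq_nonneg (Real.sqrt d * u j + 2 * (Real.sqrt d * u j - z j))]
      _ = 9 / 4 * d := by
          rw [Finset.sum_add_distrib, ← Finset.mul_sum, ← Finset.mul_sum, hu2]
          simp; ring
  refine ⟨z, ?_, ?_⟩
  · refine Finset.mem_filter.mpr ⟨Fintype.mem_piFinset.mpr fun j => ?_, hzs⟩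
    have h1 : ((z j : ℤ) : ℝ) ^ 2 ≤ (2 * d) ^ 2 := by
      have := Finset.single_le_sum (f := fun j => ((z j : ℤ) : ℝ) ^ 2)
        (fun _ _ => sq_nonneg _) (Finset.mem_univ j)
      nlinarith
    have h2 := abs_le_of_sq_le_sq' h1 (by positivity)
    rw [Finset.mem_Icc]
    constructor
    · exact_mod_cast h2.1
    · exact_mod_cast h2.2
  · unfold eNorm
    rw [Real.sqrt_le_left (by norm_num)]
    calc ∑ j, (u j - latPt z j) ^ 2 = ∑ j, (Real.sqrt d * u j - z j) ^ 2 / d := by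
          refine Finset.sum_congr rfl fun j _ => ?_
          have : u j - latPt z j = (Real.sqrt d * u j - z j) / Real.sqrt d := by
            unfold latPt; field_simp
          rw [this, div_pow, Real.sq_sqrt hd'.le]
      _ ≤ ∑ j : Fin d, (1 / 4 : ℝ) / d := by
          gcongr with j; exact he j
      _ = (1 / 2) ^ 2 := by
          simp; field_simp; norm_num

/-- matrix as an operator -/
def matLin {p d : ℕ} (V : Fin p → Fin d → ℝ) :
    EuclideanSpace ℝ (Fin d) →ₗ[ℝ] EuclideanSpace ℝ (Fin p) where
  toFun x := WithLp.toLp 2 (fun k => dotp (V k) (WithLp.ofLp x))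
  map_add' x y := by
    ext k
    simp [dotp, mul_add, Finset.sum_add_distrib]
  map_smul' c x := by
    ext k
    simp only [dotp, Finset.mul_sum, PiLp.smul_apply, smul_eq_mul, RingHom.id_apply, WithLp.ofLp_smul]
    exact Finset.sum_congr rfl fun j _ => by ring

def matOp {p d : ℕ} (V : Fin p → Fin d → ℝ) :
    EuclideanSpace ℝ (Fin d) →L[ℝ] EuclideanSpace ℝ (Fin p) :=
  LinearMap.toContinuousLinearMap (matLin V)

lemma matOp_norm {p d : ℕ} (V : Fin p → Fin d → ℝ) (x : Fin d → ℝ) :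
    eNorm (fun k => dotp (V k) x) = ‖matOp V (WithLp.toLp 2 x)‖ := by
  rw [eNorm_eq]; rfl

lemma op_bound {p d : ℕ} (hd : 0 < d) (V : Fin p → Fin d → ℝ) (r : ℝ) (hr : 0 ≤ r)
    (h : ∀ z ∈ latNet d, eNorm (fun k => dotp (V k) (latPt z)) ≤ r) : ‖matOp V‖ ≤ 2 * r := by
  have : ‖matOp V‖ ≤ r + ‖matOp V‖ * (1 / 2) := by
    refine ContinuousLinearMap.opNorm_le_of_unit_norm (by positivity) fun x hx => ?_
    obtain ⟨z, hz, hzu⟩ := latNet_round hd (WithLp.ofLp x) (by rw [eNorm_eq]; exact hx)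
    have h1 := h z hz
    rw [matOp_norm] at h1
    rw [eNorm_eq] at hzu
    have h2 : matOp V x = matOp V (WithLp.toLp 2 (latPt z))
        + matOp V (WithLp.toLp 2 (fun j => x j - latPt z j)) := by
      rw [← map_add]
      congr 1
      ext j
      simp
    rw [h2]
    refine (norm_add_le _ _).trans (add_le_add h1 ?_)
    refine ((matOp V).le_opNorm _).trans ?_
    gcongr
  linarith

/-- Operator norm event. -/
lemma op_event : ∃ T : ℝ, 0 < T ∧ ∀ p d : ℕ, 0 < d → d ≤ p →
    gaussianMatrix p d {V | ¬ ‖matOp V‖ ≤ T * Real.sqrt ((p : ℝ) / d)}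
      ≤ ENNReal.ofReal (Real.exp (-(p : ℝ))) := by
  obtain ⟨S, hS, hcard⟩ := latNet_card
  set t : ℝ := Real.log (S * Real.sqrt 2) + 1 with ht
  have h2 : (1 : ℝ) ≤ Real.sqrt 2 := by rw [Real.one_le_sqrt]; norm_num
  have hS2 : 1 ≤ S * Real.sqrt 2 := by nlinarith
  have ht0 : 0 < t := by have := Real.log_nonneg hS2; linarith
  refine ⟨2 * Real.sqrt (9 * t), by positivity, fun p d hd hdp => ?_⟩
  have hd' : (0 : ℝ) < d := by exact_mod_cast hd
  have hp' : (0 : ℝ) < p := by exact_mod_cast hd.trans_le hdp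
  set f : (Fin p → Fin d → ℝ) → ℝ := fun V =>
    ∑ z ∈ latNet d, Real.exp (∑ k, (d : ℝ) / 9 * (dotp (V k) (latPt z)) ^ 2) with hf
  have hfm : ∀ z : Fin d → ℤ, Measurable fun v : Fin d → ℝ => (d : ℝ) / 9 * (dotp v (latPt z)) ^ 2 := by
    intro z
    have := measurable_dotp (latPt z)
    fun_prop
  have hfm2 : ∀ z : Fin d → ℤ, Measurable fun V : Fin p → Fin d → ℝ =>
      Real.exp (∑ k, (d : ℝ) / 9 * (dotp (V k) (latPt z)) ^ 2) := by
    intro z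
    refine Real.measurable_exp.comp (Finset.measurable_sum _ fun k _ => ?_)
    exact (hfm z).comp (measurable_pi_apply k)
  have hInt : ∫⁻ V, ENNReal.ofReal (f V) ∂(gaussianMatrix p d)
      ≤ ENNReal.ofReal ((S * Real.sqrt 2) ^ p) := by
    have h1 : ∀ V, ENNReal.ofReal (f V) = ∑ z ∈ latNet d,
        ENNReal.ofReal (Real.exp (∑ k, (d : ℝ) / 9 * (dotp (V k) (latPt z)) ^ 2)) :=
      fun V => ENNReal.ofReal_sum_of_nonneg fun _ _ => by positivity
    rw [lintegral_congr h1, lintegral_finsetSum _ (fun z _ => (hfm2 z).ennreal_ofReal)]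
    calc _ ≤ ∑ z ∈ latNet d, ENNReal.ofReal (Real.sqrt 2) ^ p := by
          refine Finset.sum_le_sum fun z hz => ?_
          rw [mat_exp p d _ (hfm z)]
          gcongr
          apply row_exp_dotp d hd
          have := latPt_sq hd hz
          calc (d : ℝ) / 9 * ∑ j, latPt z j ^ 2 ≤ d / 9 * (9 / 4) := by gcongr
            _ = d / 4 := by ring
      _ = ENNReal.ofReal ((latNet d).card * Real.sqrt 2 ^ p) := by
          rw [ENNReal.ofReal_mul (by positivity), ENNReal.ofReal_pow (by positivity)]
          simp
      _ ≤ _ := by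
          apply ENNReal.ofReal_le_ofReal
          rw [mul_pow]
          gcongr
          exact (hcard d).trans (pow_le_pow_right₀ hS hdp)
  have hmk := markov _ f (Finset.measurable_sum _ fun z _ => hfm2 z) (Real.exp (t * p)) _
    (Real.exp_pos _) hInt
  have hexp : (S * Real.sqrt 2) ^ p / Real.exp (t * p) = Real.exp (-(p : ℝ)) := by
    rw [div_eq_iff (Real.exp_pos _).ne', ← Real.exp_add, ht]
    conv_lhs => rw [← Real.exp_log (by linarith : 0 < S * Real.sqrt 2), ← Real.exp_nat_mul]
    congr 1; ring
  rw [hexp] at hmk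
  refine (measure_mono ?_).trans hmk
  intro V hV
  by_contra hlt
  simp only [Set.mem_ofPred_eq, not_le] at hlt hV
  apply absurd hV (not_lt.mpr _)
  rw [mul_assoc]
  apply op_bound hd V _ (by positivity)
  intro z hz
  have h1 : Real.exp (∑ k, (d : ℝ) / 9 * (dotp (V k) (latPt z)) ^ 2) < Real.exp (t * p) :=
    lt_of_le_of_lt (Finset.single_le_sum
      (f := fun z => Real.exp (∑ k, (d : ℝ) / 9 * (dotp (V k) (latPt z)) ^ 2))
      (fun _ _ => by positivity) hz) hlt
  rw [Real.exp_lt_exp, ← Finset.mul_sum] at h1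
  unfold eNorm
  rw [← Real.sqrt_mul (by positivity)]
  apply Real.sqrt_le_sqrt
  rw [← mul_div_assoc, le_div_iff₀ hd']
  linarith

lemma cube_le (r : ℝ) (hr : 0 ≤ r) : r ^ 3 ≤ 15 * Real.exp (r ^ 2 / 4) := by
  have h1 : r ^ 2 / 6 + 1 ≤ Real.exp (r ^ 2 / 6) := Real.add_one_le_exp _
  have h2 : Real.exp (r ^ 2 / 4) ^ 2 = Real.exp (r ^ 2 / 6) ^ 3 := by
    rw [← Real.exp_nat_mul, ← Real.exp_nat_mul]; congr 1; push_cast; ring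
  have h3 : (r ^ 2 / 6) ^ 3 ≤ Real.exp (r ^ 2 / 6) ^ 3 := by
    gcongr; linarith
  refine (abs_le_of_sq_le_sq' ?_ (by positivity)).2
  rw [mul_pow, h2]
  have : 0 ≤ r ^ 6 := by positivity
  nlinarith

lemma cube_event : ∃ K : ℝ, 0 < K ∧ ∀ p d : ℕ, 0 < d → d ≤ p →
    gaussianMatrix p d {V | ¬ (∑ k, (eNorm (V k)) ^ 3) ≤ K * p}
      ≤ ENNReal.ofReal (Real.exp (-(d : ℝ))) := by
  refine ⟨15 * (Real.sqrt 2 * Real.exp 1), by positivity, fun p d hd hdp => ?_⟩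
  have hd' : (0 : ℝ) < d := by exact_mod_cast hd
  have hp' : (0 : ℝ) < p := by exact_mod_cast hd.trans_le hdp
  set f : (Fin p → Fin d → ℝ) → ℝ := fun V =>
    ∑ k, (p : ℝ)⁻¹ * Real.exp ((d : ℝ) / 4 * ∑ j, (V k j) ^ 2) with hf
  have hm : ∀ k : Fin p, Measurable fun V : Fin p → Fin d → ℝ =>
      ENNReal.ofReal ((p : ℝ)⁻¹ * Real.exp ((d : ℝ) / 4 * ∑ j, (V k j) ^ 2)) := by
    intro k; fun_prop
  have hInt : ∫⁻ V, ENNReal.ofReal (f V) ∂(gaussianMatrix p d)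
      ≤ ENNReal.ofReal (Real.sqrt 2 ^ d) := by
    have h1 : ∀ V, ENNReal.ofReal (f V) = ∑ k,
        ENNReal.ofReal ((p : ℝ)⁻¹ * Real.exp ((d : ℝ) / 4 * ∑ j, (V k j) ^ 2)) :=
      fun V => ENNReal.ofReal_sum_of_nonneg fun _ _ => by positivity
    rw [lintegral_congr h1, lintegral_finsetSum _ (fun k _ => hm k)]
    calc _ ≤ ∑ _k : Fin p, ENNReal.ofReal ((p : ℝ)⁻¹) * ENNReal.ofReal (Real.sqrt 2) ^ d := by
          refine Finset.sum_le_sum fun k _ => ?_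
          have h2 := (measurePreserving_eval (fun _ : Fin p => rowLaw d) k).lintegral_comp
            (f := fun v : Fin d → ℝ =>
              ENNReal.ofReal ((p : ℝ)⁻¹ * Real.exp ((d : ℝ) / 4 * ∑ j, (v j) ^ 2)))
            (by fun_prop)
          rw [gaussianMatrix_eq]
          refine h2.le.trans ?_
          simp_rw [ENNReal.ofReal_mul (inv_nonneg.mpr hp'.le)]
          rw [lintegral_const_mul _ (by fun_prop)]
          gcongr
          exact row_exp_norm d hd
      _ = _ := by
          rw [Finset.sum_const, ← ENNReal.ofReal_pow (by positivity),
            ← ENNReal.ofReal_mul (by positivity), ← ENNReal.ofReal_nsmul]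
          congr 1
          simp; field_simp
  have hmk := markov _ f (by fun_prop) ((Real.sqrt 2 * Real.exp 1) ^ d) _
    (by positivity) hInt
  have hexp : Real.sqrt 2 ^ d / (Real.sqrt 2 * Real.exp 1) ^ d = Real.exp (-(d : ℝ)) := by
    rw [mul_pow, ← Real.exp_nat_mul, mul_one, Real.exp_neg]
    field_simp
  rw [hexp] at hmk
  refine (measure_mono ?_).trans hmk
  intro V hV
  simp only [Set.mem_ofPred_eq, not_le] at hV ⊢
  have h1 : Real.sqrt 2 * Real.exp 1
      ≤ ∑ k, (p : ℝ)⁻¹ * Real.exp (eNorm (V k) ^ 2 / 4) := by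
    rw [← Finset.mul_sum, le_inv_mul_iff₀ hp']
    have : ∑ k, (eNorm (V k)) ^ 3 ≤ ∑ k, 15 * Real.exp (eNorm (V k) ^ 2 / 4) :=
      Finset.sum_le_sum fun k _ => cube_le _ (eNorm_nonneg _)
    rw [← Finset.mul_sum] at this
    linarith
  calc _ ≤ (∑ k, (p : ℝ)⁻¹ * Real.exp (eNorm (V k) ^ 2 / 4)) ^ d := by gcongr
    _ ≤ ∑ k, (p : ℝ)⁻¹ * Real.exp (eNorm (V k) ^ 2 / 4) ^ d :=
        Real.pow_arith_mean_le_arith_mean_pow _ _ _ (fun _ _ => by positivity)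
          (by simp [hp'.ne']) (fun _ _ => by positivity) d
    _ = _ := by
        refine Finset.sum_congr rfl fun k _ => ?_
        rw [← Real.exp_nat_mul, eNorm_sq]
        congr 2; ring

lemma gauss_lt_one (ψ : ℝ → ℝ) (hc : Continuous ψ) (z0 : ℝ) (hz : ψ z0 ≠ 0) :
    ∫ x, Real.exp (-(ψ x) ^ 2) ∂(gaussianReal 0 1) < 1 := by
  have hi : Integrable (fun x => Real.exp (-(ψ x) ^ 2)) (gaussianReal 0 1) := by
    refine (integrable_const (1 : ℝ)).mono' (by fun_prop) (ae_of_all _ fun x => ?_)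
    rw [Real.norm_of_nonneg (by positivity)]
    apply Real.exp_le_one_iff.mpr
    have := sq_nonneg (ψ x); linarith
  have hpos : 0 < ∫ x, (1 - Real.exp (-(ψ x) ^ 2)) ∂(gaussianReal 0 1) := by
    rw [integral_pos_iff_support_of_nonneg]
    · have ho : IsOpen (Function.support fun x => 1 - Real.exp (-(ψ x) ^ 2)) := by
        apply Continuous.isOpen_support; fun_prop
      rw [pos_iff_ne_zero]
      intro h0
      have := gaussianReal_absolutelyContinuous' 0 (one_ne_zero (α := NNReal)) h0
      refine (ho.measure_pos volume ⟨z0, ?_⟩).ne' this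
      simp only [Function.mem_support]
      have h3 : 0 < (ψ z0) ^ 2 := by positivity
      have : Real.exp (-(ψ z0) ^ 2) < 1 := by
        rw [Real.exp_lt_one_iff]; linarith
      linarith
    · intro x
      have : Real.exp (-(ψ x) ^ 2) ≤ 1 := by
        apply Real.exp_le_one_iff.mpr
        have := sq_nonneg (ψ x); linarith
      simpa using this
    · exact (integrable_const 1).sub hi
  rw [integral_sub (integrable_const 1) hi] at hpos
  simp at hpos
  simpa using hpos

lemma lower_event (ψ : ℝ → ℝ) (hc : Continuous ψ) (z0 : ℝ) (hz : ψ z0 ≠ 0) :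
    ∃ r : ℝ, 0 < r ∧ ∀ p d : ℕ, 0 < d →
      gaussianMatrix p d {V | ∑ k, (ψ (dotp (V k) (fun _ => 1))) ^ 2 ≤ r * p}
        ≤ ENNReal.ofReal (Real.exp (-(r * p))) := by
  set m := ∫ x, Real.exp (-(ψ x) ^ 2) ∂(gaussianReal 0 1) with hm
  have hm1 : m < 1 := gauss_lt_one ψ hc z0 hz
  have hi : Integrable (fun x => Real.exp (-(ψ x) ^ 2)) (gaussianReal 0 1) := by
    refine (integrable_const (1 : ℝ)).mono' (by fun_prop) (ae_of_all _ fun x => ?_)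
    rw [Real.norm_of_nonneg (by positivity)]
    apply Real.exp_le_one_iff.mpr
    have := sq_nonneg (ψ x); linarith
  have hm0 : 0 < m := integral_exp_pos hi
  have hlog : Real.log m < 0 := Real.log_neg hm0 hm1
  refine ⟨-Real.log m / 2, by linarith, fun p d hd => ?_⟩
  have hd' : (0 : ℝ) < d := by exact_mod_cast hd
  have hdm := measurable_dotp (fun _ : Fin d => (1 : ℝ))
  have hg : Measurable fun v : Fin d → ℝ => -(ψ (dotp v (fun _ => 1))) ^ 2 := by
    have := hc.measurable.comp hdm
    exact (this.pow_const 2).neg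
  have hrow : ∫⁻ v, ENNReal.ofReal (Real.exp (-(ψ (dotp v (fun _ => 1))) ^ 2)) ∂(rowLaw d)
      = ENNReal.ofReal m := by
    have := lintegral_map (μ := rowLaw d) (f := fun y => ENNReal.ofReal (Real.exp (-(ψ y) ^ 2)))
      (by fun_prop) hdm
    rw [← this, dotp_law]
    have hv : (d : NNReal)⁻¹ * Real.toNNReal (∑ _j : Fin d, (1 : ℝ) ^ 2) = 1 := by
      have : (d : NNReal) ≠ 0 := by exact_mod_cast hd.ne'
      simp [this]
    rw [hv, ← ofReal_integral_eq_lintegral_ofReal hi (ae_of_all _ fun x => by positivity)]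
  have hInt := (mat_exp p d _ hg).le
  rw [hrow, ← ENNReal.ofReal_pow hm0.le] at hInt
  have hfm : Measurable fun V : Fin p → Fin d → ℝ =>
      Real.exp (∑ k, -(ψ (dotp (V k) (fun _ => 1))) ^ 2) :=
    Real.measurable_exp.comp (Finset.measurable_sum _ fun k _ => hg.comp (measurable_pi_apply k))
  have hmk := markov _ _ hfm (Real.exp (Real.log m / 2 * p)) _ (Real.exp_pos _) hInt
  have hexp : m ^ p / Real.exp (Real.log m / 2 * p) = Real.exp (-(-Real.log m / 2 * p)) := by
    rw [div_eq_iff (Real.exp_pos _).ne', ← Real.exp_add]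
    conv_lhs => rw [← Real.exp_log hm0, ← Real.exp_nat_mul]
    congr 1; ring
  rw [hexp] at hmk
  refine (measure_mono ?_).trans hmk
  intro V hV
  simp only [Set.mem_ofPred_eq] at hV ⊢
  rw [Real.exp_le_exp, Finset.sum_neg_distrib]
  linarith

lemma feature_upper {p d : ℕ} (hd : 0 < d) (V : Fin p → Fin d → ℝ) (ψ : ℝ → ℝ) (A B T : ℝ)
    (hA : 0 ≤ A) (hB : 0 ≤ B) (hT : 0 ≤ T) (hψ : ∀ z, |ψ z| ≤ A + B * |z|)
    (hV : ‖matOp V‖ ≤ T * Real.sqrt ((p : ℝ) / d)) (x : Fin d → ℝ)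
    (hx : eNorm x = Real.sqrt d) :
    eNorm (fun k => ψ (dotp (V k) x)) ≤ Real.sqrt (2 * A ^ 2 + 2 * B ^ 2 * T ^ 2) * Real.sqrt p := by
  have hd' : (0 : ℝ) < d := by exact_mod_cast hd
  have h1 : eNorm (fun k => dotp (V k) x) ≤ T * Real.sqrt p := by
    rw [matOp_norm]
    refine ((matOp V).le_opNorm _).trans ?_
    rw [← eNorm_eq, hx]
    calc _ ≤ T * Real.sqrt ((p : ℝ) / d) * Real.sqrt d := by gcongr
      _ = T * Real.sqrt p := by
        rw [mul_assoc, ← Real.sqrt_mul (by positivity), div_mul_cancel₀ _ hd'.ne']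
  have h2 : ∑ k, (dotp (V k) x) ^ 2 ≤ T ^ 2 * p := by
    rw [← eNorm_sq (fun k => dotp (V k) x)]
    calc _ ≤ (T * Real.sqrt p) ^ 2 := by
          gcongr; exact eNorm_nonneg _
      _ = _ := by rw [mul_pow, Real.sq_sqrt (by positivity)]
  rw [← Real.sqrt_mul (by positivity)]
  apply Real.sqrt_le_sqrt
  calc ∑ k, (ψ (dotp (V k) x)) ^ 2 ≤ ∑ k, (2 * A ^ 2 + 2 * B ^ 2 * (dotp (V k) x) ^ 2) := by
        refine Finset.sum_le_sum fun k _ => ?_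
        have h := hψ (dotp (V k) x)
        have h0 := abs_nonneg (ψ (dotp (V k) x))
        rw [← sq_abs (ψ _), ← sq_abs (dotp (V k) x)]
        calc |ψ (dotp (V k) x)| ^ 2 ≤ (A + B * |dotp (V k) x|) ^ 2 := by gcongr
          _ ≤ _ := by nlinarith [sq_nonneg (A - B * |dotp (V k) x|)]
    _ = 2 * A ^ 2 * p + 2 * B ^ 2 * ∑ k, (dotp (V k) x) ^ 2 := by
        rw [Finset.sum_add_distrib, Finset.mul_sum, Finset.sum_const, Finset.card_univ,
          Fintype.card_fin, nsmul_eq_mul]; ring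
    _ ≤ 2 * A ^ 2 * p + 2 * B ^ 2 * (T ^ 2 * p) := by gcongr
    _ = _ := by ring

lemma frob_bound {p d : ℕ} (hd : 0 < d) (V : Fin p → Fin d → ℝ) (T : ℝ)
    (hV : ‖matOp V‖ ≤ T * Real.sqrt ((p : ℝ) / d)) :
    ∑ k, ∑ j, (V k j) ^ 2 ≤ T ^ 2 * p := by
  have hd' : (0 : ℝ) < d := by exact_mod_cast hd
  rw [Finset.sum_comm]
  have h : ∀ j : Fin d, ∑ k, (V k j) ^ 2 ≤ T ^ 2 * ((p : ℝ) / d) := by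
    intro j
    have h1 : ∀ k, V k j = dotp (V k) (Pi.single j 1) := by
      intro k; simp [dotp, Pi.single_apply]
    have h2 : ‖(WithLp.toLp 2 (Pi.single j 1) : EuclideanSpace ℝ (Fin d))‖ = 1 := by
      rw [← eNorm_eq]; simp [eNorm, Pi.single_apply]
    have h3 := (matOp V).le_opNorm (WithLp.toLp 2 (Pi.single j 1))
    rw [h2, mul_one, ← matOp_norm] at h3
    calc ∑ k, (V k j) ^ 2 = eNorm (fun k => dotp (V k) (Pi.single j 1)) ^ 2 := by
          rw [eNorm_sq]; simp_rw [← h1]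
      _ ≤ (T * Real.sqrt ((p : ℝ) / d)) ^ 2 := by
          gcongr
          · exact eNorm_nonneg _
          · exact h3.trans hV
      _ = _ := by rw [mul_pow, Real.sq_sqrt (by positivity)]
  calc _ ≤ ∑ _j : Fin d, T ^ 2 * ((p : ℝ) / d) := Finset.sum_le_sum fun j _ => h j
    _ = _ := by simp; field_simp

/-- **Lemma A.5 (Norms of the random features matrix and uniform feature norms).**
For `φ` non-linear, Lipschitz, with Lipschitz derivative and `μ₁ ≠ 0`, and `p ≥ d`:
there are constants `c, C, c' > 0` such that with probability at least
`1 − 2 exp(−c log² d)` over `V`, jointly: `‖V‖_op ≤ C √(p/d)`, `‖V‖_F² ≤ C p`,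
`Σₖ ‖vₖ‖₂³ ≤ C p`, and the suprema of `‖φ(x)‖₂` and `‖φ̃(x)‖₂` over the sphere of radius
`√d` are between `c' √p` and `C √p`. -/
theorem random_features_matrix_norms
    (φ : ℝ → ℝ) (hnl : ¬ ∃ a b : ℝ, ∀ z, φ z = a * z + b)
    (hLip : ∃ L : NNReal, LipschitzWith L φ)
    (hdiff : Differentiable ℝ φ) (hLip' : ∃ L' : NNReal, LipschitzWith L' (deriv φ))
    (hmu1 : hermiteCoeff φ 1 ≠ 0) :
    ∃ c : ℝ, 0 < c ∧ ∃ C : ℝ, 0 < C ∧ ∃ c' : ℝ, 0 < c' ∧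
      ∀ (p d : ℕ), d ≤ p →
        1 - ENNReal.ofReal (2 * Real.exp (-c * (Real.log d) ^ 2)) ≤
          gaussianMatrix p d
            {V | (⨆ u : {u : Fin d → ℝ // eNorm u = 1},
                    eNorm (fun k => dotp (V k) u.1)) ≤ C * Real.sqrt ((p : ℝ) / d) ∧
              (∑ k, ∑ j, (V k j) ^ 2) ≤ C * p ∧
              (∑ k, (eNorm (V k)) ^ 3) ≤ C * p ∧
              (c' * Real.sqrt p ≤
                  (⨆ x : {x : Fin d → ℝ // eNorm x = Real.sqrt d},
                    eNorm (featureMap φ V x.1)) ∧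
                (⨆ x : {x : Fin d → ℝ // eNorm x = Real.sqrt d},
                    eNorm (featureMap φ V x.1)) ≤ C * Real.sqrt p) ∧
              (c' * Real.sqrt p ≤
                  (⨆ x : {x : Fin d → ℝ // eNorm x = Real.sqrt d},
                    eNorm (tfeatureMap φ V x.1)) ∧
                (⨆ x : {x : Fin d → ℝ // eNorm x = Real.sqrt d},
                    eNorm (tfeatureMap φ V x.1)) ≤ C * Real.sqrt p)} := by
  obtain ⟨L, hL⟩ := hLip
  obtain ⟨T, hT, hop⟩ := op_event
  obtain ⟨K, hK, hcube⟩ := cube_event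
  set m1 := hermiteCoeff φ 1 with hm1
  set ψ : ℝ → ℝ := fun z => φ z - m1 * z with hψ
  have hcφ : Continuous φ := hL.continuous
  have hcψ : Continuous ψ := by fun_prop
  obtain ⟨z1, hz1⟩ : ∃ z, φ z ≠ 0 := by
    by_contra hcon
    push Not at hcon
    exact hnl ⟨0, 0, fun z => by simp [hcon z]⟩
  obtain ⟨z2, hz2⟩ : ∃ z, ψ z ≠ 0 := by
    by_contra hcon
    push Not at hcon
    exact hnl ⟨m1, 0, fun z => by have := hcon z; simp only [hψ] at this; linarith⟩
  obtain ⟨r1, hr1, hlow1⟩ := lower_event φ hcφ z1 hz1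
  obtain ⟨r2, hr2, hlow2⟩ := lower_event ψ hcψ z2 hz2
  have hbφ : ∀ z, |φ z| ≤ |φ 0| + L * |z| := by
    intro z
    have h := hL.dist_le_mul z 0
    rw [Real.dist_eq, Real.dist_eq, sub_zero] at h
    have h2 := abs_sub_abs_le_abs_sub (φ z) (φ 0)
    linarith
  have hbψ : ∀ z, |ψ z| ≤ |φ 0| + (L + |m1|) * |z| := by
    intro z
    have h2 := abs_sub (φ z) (m1 * z)
    rw [abs_mul] at h2
    have := hbφ z
    simp only [hψ]
    linarith
  set U1 := Real.sqrt (2 * |φ 0| ^ 2 + 2 * (L : ℝ) ^ 2 * T ^ 2) with hU1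
  set U2 := Real.sqrt (2 * |φ 0| ^ 2 + 2 * ((L : ℝ) + |m1|) ^ 2 * T ^ 2) with hU2
  have hU1n : 0 ≤ U1 := Real.sqrt_nonneg _
  have hU2n : 0 ≤ U2 := Real.sqrt_nonneg _
  set γ := min 1 (min r1 r2) with hγ
  have hγ0 : 0 < γ := lt_min one_pos (lt_min hr1 hr2)
  have hγ1 : γ ≤ 1 := min_le_left _ _
  have hγr1 : γ ≤ r1 := (min_le_right _ _).trans (min_le_left _ _)
  have hγr2 : γ ≤ r2 := (min_le_right _ _).trans (min_le_right _ _)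
  have hT2 : 0 < T ^ 2 := by positivity
  refine ⟨γ / 8, by positivity, T + T ^ 2 + K + U1 + U2, by positivity,
    Real.sqrt γ, by positivity, fun p d hdp => ?_⟩
  by_cases htriv : 1 ≤ 2 * Real.exp (-(γ / 8) * (Real.log d) ^ 2)
  · have : (1 : ENNReal) ≤ ENNReal.ofReal (2 * Real.exp (-(γ / 8) * (Real.log d) ^ 2)) := by
      rw [← ENNReal.ofReal_one]; exact ENNReal.ofReal_le_ofReal htriv
    rw [tsub_eq_zero_of_le this]
    exact zero_le
  have hd : 0 < d := by
    rcases Nat.eq_zero_or_pos d with h | h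
    · exfalso; apply htriv; rw [h]; norm_num
    · exact h
  push Not at htriv
  have hd' : (0 : ℝ) < d := by exact_mod_cast hd
  have hdp' : (d : ℝ) ≤ p := by exact_mod_cast hdp
  have hp' : (0 : ℝ) < p := hd'.trans_le hdp'
  have hnum : 4 * Real.exp (-(γ * d)) ≤ 2 * Real.exp (-(γ / 8) * (Real.log d) ^ 2) := by
    have h1 := Real.log_sqrt hd'.le
    have h2 := Real.log_le_self (Real.sqrt_nonneg (d : ℝ))
    have h3 : 0 ≤ Real.log d := Real.log_natCast_nonneg d
    have h4 : (Real.log d) ^ 2 ≤ 4 * d := by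
      have := Real.sq_sqrt hd'.le
      nlinarith [Real.sqrt_nonneg (d : ℝ)]
    have h5 : Real.exp (-(γ * d)) = Real.exp (-(γ * d) / 2) ^ 2 := by
      rw [← Real.exp_nat_mul]; congr 1; push_cast; ring
    have h6 : Real.exp (-(γ * d) / 2) ≤ Real.exp (-(γ / 8) * (Real.log d) ^ 2) := by
      apply Real.exp_le_exp.mpr; nlinarith
    have h7 := Real.exp_pos (-(γ * d) / 2)
    rw [h5]
    nlinarith
  set S := {V : Fin p → Fin d → ℝ | _} with hS
  set B1 := {V : Fin p → Fin d → ℝ | ¬ ‖matOp V‖ ≤ T * Real.sqrt ((p : ℝ) / d)}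
  set B2 := {V : Fin p → Fin d → ℝ | ¬ (∑ k, (eNorm (V k)) ^ 3) ≤ K * p}
  set B3 := {V : Fin p → Fin d → ℝ | ∑ k, (φ (dotp (V k) (fun _ => 1))) ^ 2 ≤ r1 * p}
  set B4 := {V : Fin p → Fin d → ℝ | ∑ k, (ψ (dotp (V k) (fun _ => 1))) ^ 2 ≤ r2 * p}
  have hcover : (Set.univ : Set (Fin p → Fin d → ℝ)) ⊆ S ∪ (B1 ∪ B2 ∪ (B3 ∪ B4)) := by
    intro V _
    by_cases hb : V ∈ B1 ∪ B2 ∪ (B3 ∪ B4)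
    · exact Or.inr hb
    left
    simp only [Set.mem_union, not_or, B1, B2, B3, B4, Set.mem_ofPred_eq, not_le] at hb
    obtain ⟨⟨g1, g2⟩, g3, g4⟩ := hb
    rw [not_lt] at g1 g2
    have hsup1 := fun x hx => feature_upper hd V φ _ _ T (abs_nonneg (φ 0)) L.coe_nonneg hT.le hbφ g1 x hx
    have hsup2 := fun x hx => feature_upper hd V ψ _ _ T (abs_nonneg (φ 0))
      (add_nonneg L.coe_nonneg (abs_nonneg m1)) hT.le hbψ g1 x hx
    have hone : eNorm (fun _ : Fin d => (1 : ℝ)) = Real.sqrt d := by simp [eNorm]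
    have hsp : 0 ≤ Real.sqrt p := Real.sqrt_nonneg _
    have hspd : 0 ≤ Real.sqrt ((p : ℝ) / d) := Real.sqrt_nonneg _
    have hne : Nonempty {x : Fin d → ℝ // eNorm x = Real.sqrt d} := ⟨⟨_, hone⟩⟩
    refine ⟨?_, ?_, ?_, ⟨?_, ?_⟩, ⟨?_, ?_⟩⟩
    · refine Real.iSup_le (fun u => ?_) (by positivity)
      rw [matOp_norm]
      calc _ ≤ ‖matOp V‖ * ‖(WithLp.toLp 2 u.1 : EuclideanSpace ℝ (Fin d))‖ :=
            (matOp V).le_opNorm _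
        _ = ‖matOp V‖ := by rw [← eNorm_eq, u.2, mul_one]
        _ ≤ T * Real.sqrt ((p : ℝ) / d) := g1
        _ ≤ _ := by gcongr; linarith
    · refine (frob_bound hd V T g1).trans ?_
      gcongr; linarith
    · refine g2.trans ?_
      gcongr; linarith
    · refine le_trans ?_ (le_ciSup ⟨U1 * Real.sqrt p, ?_⟩ ⟨_, hone⟩)
      · rw [← Real.sqrt_mul hγ0.le]
        apply Real.sqrt_le_sqrt
        refine le_trans ?_ g3.le
        gcongr
      · rintro _ ⟨x, rfl⟩
        exact hsup1 x.1 x.2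
    · refine ciSup_le fun x => (hsup1 x.1 x.2).trans ?_
      rw [← hU1]; gcongr; linarith
    · refine le_trans ?_ (le_ciSup ⟨U2 * Real.sqrt p, ?_⟩ ⟨_, hone⟩)
      · rw [← Real.sqrt_mul hγ0.le]
        apply Real.sqrt_le_sqrt
        refine le_trans ?_ g4.le
        gcongr
      · rintro _ ⟨x, rfl⟩
        exact hsup2 x.1 x.2
    · refine ciSup_le fun x => (hsup2 x.1 x.2).trans ?_
      rw [← hU2]; gcongr; linarith
  have hb1 : gaussianMatrix p d B1 ≤ ENNReal.ofReal (Real.exp (-(γ * d))) := by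
    refine (hop p d hd hdp).trans (ENNReal.ofReal_le_ofReal (Real.exp_le_exp.mpr ?_))
    nlinarith
  have hb2 : gaussianMatrix p d B2 ≤ ENNReal.ofReal (Real.exp (-(γ * d))) := by
    refine (hcube p d hd hdp).trans (ENNReal.ofReal_le_ofReal (Real.exp_le_exp.mpr ?_))
    nlinarith
  have hb3 : gaussianMatrix p d B3 ≤ ENNReal.ofReal (Real.exp (-(γ * d))) := by
    refine (hlow1 p d hd).trans (ENNReal.ofReal_le_ofReal (Real.exp_le_exp.mpr ?_))
    have : γ * d ≤ r1 * p := by gcongr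
    linarith
  have hb4 : gaussianMatrix p d B4 ≤ ENNReal.ofReal (Real.exp (-(γ * d))) := by
    refine (hlow2 p d hd).trans (ENNReal.ofReal_le_ofReal (Real.exp_le_exp.mpr ?_))
    have : γ * d ≤ r2 * p := by gcongr
    linarith
  rw [tsub_le_iff_right]
  calc (1 : ENNReal) = gaussianMatrix p d Set.univ := measure_univ.symm
    _ ≤ gaussianMatrix p d (S ∪ (B1 ∪ B2 ∪ (B3 ∪ B4))) := measure_mono hcover
    _ ≤ gaussianMatrix p d S + ((gaussianMatrix p d B1 + gaussianMatrix p d B2)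
          + (gaussianMatrix p d B3 + gaussianMatrix p d B4)) := by
        refine (measure_union_le _ _).trans (add_le_add le_rfl ?_)
        exact (measure_union_le _ _).trans
          (add_le_add (measure_union_le _ _) (measure_union_le _ _))
    _ ≤ gaussianMatrix p d S + ENNReal.ofReal (2 * Real.exp (-(γ / 8) * (Real.log d) ^ 2)) := by
        gcongr
        refine (add_le_add (add_le_add hb1 hb2) (add_le_add hb3 hb4)).trans ?_
        rw [← ENNReal.ofReal_add (by positivity) (by positivity),
          ← ENNReal.ofReal_add (by positivity) (by positivity)]
        apply ENNReal.ofReal_le_ofReal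
        linarith
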